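/- Let p > 0 and let (Aₙ) be a sequence of compact operators on a Hilbert space such that: (i) sup_k (k+1)^{1/p} μ(k, Aₙ − A) → 0 as n → ∞ (convergence in the weak Schatten quasi-norm), and (ii) for each n the limit cₙ := lim_{k→∞} (k+1)^{1/p} μ(k, Aₙ) exists. Then lim_{n→∞} cₙ exists, the limit lim_{k→∞} (k+1)^{1/p} μ(k, A) exists, and the two limits are equal. -/

import Mathlib

open Filter

/-- The `n`-th singular value (approximation number)
`μ(n, T) = inf{‖T − R‖ : rank R ≤ n}` of an operator on a Hilbert space. -/
noncomputable def singVal {H : Type*} [NormedAddCommGroup H]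
    [InnerProductSpace ℂ H] (T : H →L[ℂ] H) (n : ℕ) : ℝ :=
  sInf {c : ℝ | ∃ R : H →L[ℂ] H,
    Module.rank ℂ (LinearMap.range (R : H →ₗ[ℂ] H)) ≤ (n : Cardinal) ∧
      c = ‖T - R‖}

theorem singVal_bdd {H : Type*} [NormedAddCommGroup H]
    [InnerProductSpace ℂ H] (T : H →L[ℂ] H) (n : ℕ) :
    BddBelow {c : ℝ | ∃ R : H →L[ℂ] H,
      Module.rank ℂ (LinearMap.range (R : H →ₗ[ℂ] H)) ≤ (n : Cardinal) ∧ c = ‖T - R‖} :=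
  ⟨0, by rintro c ⟨R, _, rfl⟩; exact norm_nonneg _⟩

theorem singVal_ne {H : Type*} [NormedAddCommGroup H]
    [InnerProductSpace ℂ H] (T : H →L[ℂ] H) (n : ℕ) :
    Set.Nonempty {c : ℝ | ∃ R : H →L[ℂ] H,
      Module.rank ℂ (LinearMap.range (R : H →ₗ[ℂ] H)) ≤ (n : Cardinal) ∧ c = ‖T - R‖} := by
  refine ⟨‖T - 0‖, 0, ?_, rfl⟩
  have : LinearMap.rank (0 : H →ₗ[ℂ] H) = 0 := LinearMap.rank_zero
  have h2 : Module.rank ℂ (LinearMap.range (0 : H →ₗ[ℂ] H)) = 0 := this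
  rw [ContinuousLinearMap.toLinearMap_zero, h2]
  exact zero_le

theorem singVal_nonneg {H : Type*} [NormedAddCommGroup H]
    [InnerProductSpace ℂ H] (T : H →L[ℂ] H) (n : ℕ) : 0 ≤ singVal T n := by
  apply Real.sInf_nonneg
  rintro c ⟨R, _, rfl⟩
  exact norm_nonneg _

theorem singVal_exists {H : Type*} [NormedAddCommGroup H]
    [InnerProductSpace ℂ H] (T : H →L[ℂ] H) (n : ℕ) (e : ℝ) (he : 0 < e) :
    ∃ R : H →L[ℂ] H, LinearMap.rank (R : H →ₗ[ℂ] H) ≤ (n : Cardinal) ∧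
      ‖T - R‖ < singVal T n + e := by
  obtain ⟨c, ⟨R, hR, rfl⟩, h⟩ := Real.lt_sInf_add_pos (singVal_ne T n) he
  exact ⟨R, hR, h⟩

theorem singVal_add_le {H : Type*} [NormedAddCommGroup H]
    [InnerProductSpace ℂ H] (S T : H →L[ℂ] H) (j k : ℕ) :
    singVal (S + T) (j + k) ≤ singVal S j + singVal T k := by
  apply le_of_forall_pos_le_add
  intro e he
  obtain ⟨R, hR, h1⟩ := singVal_exists S j (e / 2) (by linarith)
  obtain ⟨Q, hQ, h2⟩ := singVal_exists T k (e / 2) (by linarith)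
  have h3 : singVal (S + T) (j + k) ≤ ‖(S + T) - (R + Q)‖ := by
    apply csInf_le (singVal_bdd _ _)
    refine ⟨R + Q, ?_, rfl⟩
    have := LinearMap.rank_add_le (R : H →ₗ[ℂ] H) (Q : H →ₗ[ℂ] H)
    push_cast
    exact this.trans (add_le_add hR hQ)
  have h4 : (S + T) - (R + Q) = (S - R) + (T - Q) := by abel
  rw [h4] at h3
  have := norm_add_le (S - R) (T - Q)
  linarith

theorem singVal_neg_le {H : Type*} [NormedAddCommGroup H]
    [InnerProductSpace ℂ H] (T : H →L[ℂ] H) (k : ℕ) :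
    singVal (-T) k ≤ singVal T k := by
  apply le_of_forall_pos_le_add
  intro e he
  obtain ⟨R, hR, h1⟩ := singVal_exists T k e he
  have h3 : singVal (-T) k ≤ ‖(-T) - (-R)‖ := by
    apply csInf_le (singVal_bdd _ _)
    refine ⟨-R, ?_, rfl⟩
    have h : LinearMap.range ((-R : H →L[ℂ] H) : H →ₗ[ℂ] H) =
        LinearMap.range (R : H →ₗ[ℂ] H) := by
      rw [ContinuousLinearMap.toLinearMap_neg, LinearMap.range_neg]
    rw [h]
    exact hR
  have h4 : (-T) - (-R) = -(T - R) := by abel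
  rw [h4, norm_neg] at h3
  linarith

/-- Weighted Fan inequality. -/
theorem singVal_weighted {H : Type*} [NormedAddCommGroup H]
    [InnerProductSpace ℂ H] (S T : H →L[ℂ] H) (q : ℝ) (hq : 0 < q) (j k : ℕ)
    (r C e : ℝ) (hr : 0 ≤ r) (hC : 0 ≤ C)
    (h1 : ((k + j : ℕ) : ℝ) + 1 ≤ r * ((k : ℝ) + 1))
    (h2 : ((k + j : ℕ) : ℝ) + 1 ≤ C * ((j : ℝ) + 1))
    (he : ((j : ℝ) + 1) ^ q * singVal (S - T) j ≤ e) :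
    (((k + j : ℕ) : ℝ) + 1) ^ q * singVal S (k + j) ≤
      r ^ q * (((k : ℝ) + 1) ^ q * singVal T k) + C ^ q * e := by
  have h0 : singVal S (k + j) ≤ singVal T k + singVal (S - T) j := by
    have := singVal_add_le T (S - T) k j
    rwa [add_sub_cancel] at this
  have a1 := Real.rpow_le_rpow (by positivity) h1 hq.le
  have a2 := Real.rpow_le_rpow (by positivity) h2 hq.le
  rw [Real.mul_rpow hr (by positivity)] at a1
  rw [Real.mul_rpow hC (by positivity)] at a2
  have n1 := singVal_nonneg T k
  have n2 := singVal_nonneg (S - T) j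
  have hCq : 0 ≤ C ^ q := Real.rpow_nonneg hC q
  calc _ ≤ (((k + j : ℕ) : ℝ) + 1) ^ q * (singVal T k + singVal (S - T) j) := by gcongr
    _ = (((k + j : ℕ) : ℝ) + 1) ^ q * singVal T k
        + (((k + j : ℕ) : ℝ) + 1) ^ q * singVal (S - T) j := by ring
    _ ≤ (r ^ q * ((k : ℝ) + 1) ^ q) * singVal T k
        + (C ^ q * ((j : ℝ) + 1) ^ q) * singVal (S - T) j := by gcongr
    _ = r ^ q * (((k : ℝ) + 1) ^ q * singVal T k)
        + C ^ q * (((j : ℝ) + 1) ^ q * singVal (S - T) j) := by ring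
    _ ≤ _ := by gcongr

/-- The purely real-analytic part. -/
theorem real_limit_part (a c : ℕ → ℝ) (b : ℕ → ℕ → ℝ) (r C : ℕ → ℝ)
    (hr : ∀ s, 1 ≤ r s) (hrl : Tendsto r atTop (nhds 1))
    (ha : ∀ k, 0 ≤ a k)
    (hb : ∀ n, Tendsto (b n) atTop (nhds (c n)))
    (H : ∀ e > (0 : ℝ), ∃ N : ℕ, ∀ n ≥ N, ∀ s k : ℕ,
      a k ≤ r s * b n (k - k / (s + 2)) + C s * e ∧
      b n (k + k / (s + 1)) ≤ r s * a k + C s * e) :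
    ∃ L : ℝ, Tendsto c atTop (nhds L) ∧ Tendsto a atTop (nhds L) := by
  have t1 : ∀ s : ℕ, Tendsto (fun k : ℕ => k - k / (s + 2)) atTop atTop := by
    intro s
    apply tendsto_atTop_atTop.2
    intro m
    refine ⟨2 * m, fun k hk => ?_⟩
    have : k / (s + 2) ≤ k / 2 := Nat.div_le_div_left (by omega) (by omega)
    omega
  have t2 : ∀ s : ℕ, Tendsto (fun k : ℕ => k + k / (s + 1)) atTop atTop := by
    intro s
    apply tendsto_atTop_mono (fun k => Nat.le_add_right k _) tendsto_id
  have bddA : IsBoundedUnder (· ≤ ·) atTop a := by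
    obtain ⟨N, hN⟩ := H 1 one_pos
    have h1 : Tendsto (fun k : ℕ => r 0 * b N (k - k / (0 + 2)) + C 0 * 1) atTop
        (nhds (r 0 * c N + C 0 * 1)) :=
      (((hb N).comp (t1 0)).const_mul (r 0)).add_const _
    exact h1.isBoundedUnder_le.mono_le
      (Eventually.of_forall fun k => (hN N le_rfl 0 k).1)
  have bddB : IsBoundedUnder (· ≥ ·) atTop a :=
    isBoundedUnder_of ⟨0, ha⟩
  set U := limsup a atTop with hU
  set l := liminf a atTop with hl
  have key : ∀ e > (0 : ℝ), ∃ N : ℕ, ∀ n ≥ N, ∀ s : ℕ,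
      U ≤ r s * c n + C s * e ∧ c n ≤ r s * l + C s * e := by
    intro e he
    obtain ⟨N, hN⟩ := H e he
    refine ⟨N, fun n hn s => ⟨?_, ?_⟩⟩
    · have h1 : Tendsto (fun k : ℕ => r s * b n (k - k / (s + 2)) + C s * e) atTop
          (nhds (r s * c n + C s * e)) :=
        (((hb n).comp (t1 s)).const_mul (r s)).add_const _
      rw [← h1.limsup_eq]
      exact limsup_le_limsup (Eventually.of_forall fun k => (hN n hn s k).1)
        bddB.isCoboundedUnder_le h1.isBoundedUnder_le
    · have hrs : 0 < r s := lt_of_lt_of_le one_pos (hr s)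
      have h1 : Tendsto (fun k : ℕ => (b n (k + k / (s + 1)) - C s * e) / r s) atTop
          (nhds ((c n - C s * e) / r s)) :=
        (((hb n).comp (t2 s)).sub_const _).div_const _
      have h2 : (c n - C s * e) / r s ≤ l := by
        rw [← h1.liminf_eq]
        refine liminf_le_liminf (Eventually.of_forall fun k => ?_)
          h1.isBoundedUnder_ge bddA.isCoboundedUnder_ge
        have := (hN n hn s k).2
        show _ / _ ≤ _
        rw [div_le_iff₀ hrs]
        linarith
      rw [div_le_iff₀ hrs] at h2
      linarith
  have key2 : ∀ η > (0 : ℝ), ∃ N : ℕ, ∀ n ≥ N, U - η < c n ∧ c n < l + η := by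
    intro η hη
    have e1 : Tendsto (fun s => r s * (U - η)) atTop (nhds (1 * (U - η))) :=
      hrl.mul_const _
    have e2 : Tendsto (fun s => r s * l) atTop (nhds (1 * l)) := hrl.mul_const _
    obtain ⟨s, hs1, hs2⟩ := ((e1.eventually_lt_const (u := U) (by linarith)).and
      (e2.eventually_lt_const (u := l + η) (by linarith))).exists
    have f : Tendsto (fun e : ℝ => C s * e) (nhdsWithin 0 (Set.Ioi 0)) (nhds (C s * 0)) :=
      (tendsto_id.mono_left nhdsWithin_le_nhds).const_mul _
    rw [mul_zero] at f
    obtain ⟨e, ⟨he1, he2⟩, he⟩ := (((f.eventually_lt_const (u := U - r s * (U - η))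
      (by linarith)).and (f.eventually_lt_const (u := l + η - r s * l)
      (by linarith))).and self_mem_nhdsWithin).exists
    obtain ⟨N, hN⟩ := key e he
    refine ⟨N, fun n hn => ?_⟩
    obtain ⟨h1, h2⟩ := hN n hn s
    have hrs : 0 < r s := lt_of_lt_of_le one_pos (hr s)
    refine ⟨?_, by linarith⟩
    have : r s * (U - η) < r s * c n := by linarith
    exact lt_of_mul_lt_mul_left this hrs.le
  have hUl : U ≤ l := by
    apply le_of_forall_pos_le_add
    intro η hη
    obtain ⟨N, hN⟩ := key2 (η / 2) (by linarith)
    have := hN N le_rfl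
    linarith [this.1, this.2]
  have hlU : l ≤ U := liminf_le_limsup bddA bddB
  have hEq : l = U := le_antisymm hlU hUl
  refine ⟨U, ?_, tendsto_of_liminf_eq_limsup hEq rfl bddA bddB⟩
  rw [Metric.tendsto_atTop]
  intro η hη
  obtain ⟨N, hN⟩ := key2 η hη
  refine ⟨N, fun n hn => ?_⟩
  have := hN n hn
  rw [Real.dist_eq, abs_lt]
  constructor <;> linarith [this.1, this.2]

/-- Approximation lemma for Weyl asymptotics: if compact operators `Aₙ`
converge to `A` in the weak Schatten quasi-norm
`sup_k (k+1)^{1/p} μ(k, Aₙ − A) → 0`, and each `Aₙ` satisfies the Weyl law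
`(k+1)^{1/p} μ(k, Aₙ) → cₙ`, then `lim cₙ` exists, `(k+1)^{1/p} μ(k, A)`
converges, and the two limits coincide. -/
theorem singVal_asymptotics_approximation {H : Type*} [NormedAddCommGroup H]
    [InnerProductSpace ℂ H] [CompleteSpace H]
    (p : ℝ) (hp : 0 < p) (A : H →L[ℂ] H) (Aseq : ℕ → (H →L[ℂ] H))
    (hAc : IsCompactOperator A) (hAnc : ∀ n, IsCompactOperator (Aseq n))
    (c : ℕ → ℝ)
    (happrox : ∀ ε > (0 : ℝ), ∃ N : ℕ, ∀ n ≥ N, ∀ k : ℕ,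
      ((k : ℝ) + 1) ^ (1 / p) * singVal (Aseq n - A) k ≤ ε)
    (hc : ∀ n : ℕ,
      Tendsto (fun k : ℕ => ((k : ℝ) + 1) ^ (1 / p) * singVal (Aseq n) k)
        atTop (nhds (c n))) :
    ∃ L : ℝ, Tendsto c atTop (nhds L) ∧
      Tendsto (fun k : ℕ => ((k : ℝ) + 1) ^ (1 / p) * singVal A k)
        atTop (nhds L) := by
  have hq : 0 < 1 / p := by positivity
  set q := 1 / p
  have hbase : ∀ s : ℕ, (1 : ℝ) ≤ 1 + 1 / ((s : ℝ) + 1) := fun s => by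
    have : (0 : ℝ) ≤ 1 / ((s : ℝ) + 1) := by positivity
    linarith
  refine real_limit_part _ c (fun n k => ((k : ℝ) + 1) ^ q * singVal (Aseq n) k)
    (fun s => (1 + 1 / ((s : ℝ) + 1)) ^ q) (fun s => ((s : ℝ) + 2) ^ q) ?_ ?_ ?_ hc ?_
  · intro s
    exact Real.one_le_rpow (hbase s) hq.le
  · have h := (tendsto_one_div_add_atTop_nhds_zero_nat (𝕜 := ℝ)).const_add 1
    have h2 := h.rpow_const (p := q) (Or.inr hq.le)
    simpa using h2
  · intro k
    have := singVal_nonneg A k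
    positivity
  · intro e he
    obtain ⟨N, hN⟩ := happrox e he
    refine ⟨N, fun n hn s k => ⟨?_, ?_⟩⟩
    · have hdm := Nat.div_add_mod k (s + 2)
      have hlt := Nat.mod_lt k (show 0 < s + 2 by omega)
      have hle : k / (s + 2) ≤ k := Nat.div_le_self _ _
      have hneg : ((((k / (s + 2) : ℕ)) : ℝ) + 1) ^ q * singVal (A - Aseq n) (k / (s + 2)) ≤ e := by
        refine le_trans ?_ (hN n hn (k / (s + 2)))
        have := singVal_neg_le (Aseq n - A) (k / (s + 2))
        rw [neg_sub] at this
        gcongr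
      have hk : k - k / (s + 2) + k / (s + 2) = k := Nat.sub_add_cancel hle
      have main := singVal_weighted A (Aseq n) q hq (k / (s + 2)) (k - k / (s + 2))
        (1 + 1 / ((s : ℝ) + 1)) ((s : ℝ) + 2) e (by linarith [hbase s]) (by positivity)
        ?_ ?_ hneg
      · rw [hk] at main
        exact main
      · rw [hk, Nat.cast_sub hle]
        have h1 : (s + 2) * (k / (s + 2)) ≤ k := by omega
        have h1' : ((s : ℝ) + 2) * ((k / (s + 2) : ℕ) : ℝ) ≤ k := by exact_mod_cast h1
        have hs : (0 : ℝ) < (s : ℝ) + 1 := by positivity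
        have : (1 + 1 / ((s : ℝ) + 1)) = ((s : ℝ) + 2) / ((s : ℝ) + 1) := by field_simp; ring
        rw [this, div_mul_eq_mul_div, le_div_iff₀ hs]
        nlinarith
      · rw [hk]
        have h1 : k + 1 ≤ (s + 2) * (k / (s + 2) + 1) := by rw [mul_add]; omega
        exact_mod_cast h1
    · have hdm := Nat.div_add_mod k (s + 1)
      have hlt := Nat.mod_lt k (show 0 < s + 1 by omega)
      refine singVal_weighted (Aseq n) A q hq (k / (s + 1)) k
        (1 + 1 / ((s : ℝ) + 1)) ((s : ℝ) + 2) e (by linarith [hbase s]) (by positivity)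
        ?_ ?_ (hN n hn _)
      · have h1 : (s + 1) * (k / (s + 1)) ≤ k := by omega
        have h1' : ((s : ℝ) + 1) * ((k / (s + 1) : ℕ) : ℝ) ≤ k := by exact_mod_cast h1
        have hs : (0 : ℝ) < (s : ℝ) + 1 := by positivity
        have : (1 + 1 / ((s : ℝ) + 1)) = ((s : ℝ) + 2) / ((s : ℝ) + 1) := by field_simp; ring
        rw [this, div_mul_eq_mul_div, le_div_iff₀ hs, Nat.cast_add]
        nlinarith
      · have h1 : k + k / (s + 1) + 1 ≤ (s + 2) * (k / (s + 1) + 1) := by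
          have : (s + 2) * (k / (s + 1) + 1) = (s + 1) * (k / (s + 1)) + (s + 1) + k / (s + 1) + 1 := by
            ring
          omega
        exact_mod_cast h1
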